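/- Let X be a separable real Fréchet space whose topology is given by a countable family of norms (p_n), let Y be a real Banach space, and let f : X → Y be a function such that for some k, the image under f of every Cauchy sequence with respect to the norm p_k is a convergent sequence in Y. Then f is continuous on X and, assuming that the completion of (X, p_k) admits a separating polynomial, for every ε > 0 there exists a function h : X → Y, analytic with respect to the norm p_k, with ‖f(x) − h(x)‖ < ε for all x ∈ X. -/

import Mathlib

open Filter Topology

/-- The Fréchet-style distance attached to a countable family of seminorms. -/
noncomputable def frechetDist {X : Type*} [AddCommGroup X] [Module ℝ X]
    (p : ℕ → Seminorm ℝ X) (x y : X) : ℝ :=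
  ∑' n : ℕ, (1 / 2 : ℝ) ^ (n + 1) * (p n (x - y) / (1 + p n (x - y)))

/-- A multilinear map bounded with respect to the seminorm `p`. -/
def BoundedWrt {X Y : Type*} [AddCommGroup X] [Module ℝ X]
    [NormedAddCommGroup Y] [NormedSpace ℝ Y] (p : Seminorm ℝ X) {n : ℕ}
    (B : MultilinearMap ℝ (fun _ : Fin n => X) Y) : Prop :=
  ∃ C : ℝ, ∀ v : Fin n → X, ‖B v‖ ≤ C * ∏ i, p (v i)

/-- `h : X → Y` is analytic with respect to the norm `p`: around every point it is the
uniform limit on a `p`-ball of the partial sums of a series of `p`-bounded homogeneous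
polynomials. -/
def AnalyticWrt {X Y : Type*} [AddCommGroup X] [Module ℝ X]
    [NormedAddCommGroup Y] [NormedSpace ℝ Y] (p : Seminorm ℝ X) (h : X → Y) : Prop :=
  ∀ x : X, ∃ r > (0:ℝ), ∃ B : (n : ℕ) → MultilinearMap ℝ (fun _ : Fin n => X) Y,
    (∀ n, BoundedWrt p (B n)) ∧
    ∀ ε > (0:ℝ), ∃ N : ℕ, ∀ m ≥ N, ∀ y : X, p (y - x) < r →
      ‖h y - ∑ n ∈ Finset.range m, B n (fun _ => y - x)‖ < ε


section KZ
variable {E F : Type*} [NormedAddCommGroup E] [NormedSpace ℝ E]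
  [NormedAddCommGroup F] [NormedSpace ℝ F]

/-- `g` is a homogeneous polynomial of degree `n` given by a multilinear map bounded by `c`. -/
def HomMaj (n : ℕ) (g : E → F) (c : ℝ) : Prop :=
  0 ≤ c ∧ ∃ B : MultilinearMap ℝ (fun _ : Fin n => E) F,
    (∀ v, ‖B v‖ ≤ c * ∏ i, ‖v i‖) ∧ ∀ y, g y = B (fun _ => y)

theorem HomMaj.norm_le {n : ℕ} {g : E → F} {c : ℝ} (h : HomMaj n g c) (y : E) :
    ‖g y‖ ≤ c * ‖y‖ ^ n := by
  obtain ⟨_, B, hB, hg⟩ := h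
  simpa [hg] using hB (fun _ => y)

theorem HomMaj.norm_le' {n : ℕ} {g : E → F} {c r : ℝ} (h : HomMaj n g c) {y : E}
    (hy : ‖y‖ ≤ r) : ‖g y‖ ≤ c * r ^ n :=
  (h.norm_le y).trans (by have := h.1; gcongr)

theorem HomMaj.zero (n : ℕ) : HomMaj n (fun _ : E => (0 : F)) 0 :=
  ⟨le_rfl, 0, by simp, by simp⟩

theorem HomMaj.add {n : ℕ} {g g' : E → F} {c c' : ℝ} (h : HomMaj n g c) (h' : HomMaj n g' c') :
    HomMaj n (fun y => g y + g' y) (c + c') := by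
  obtain ⟨h0, B, hB, hg⟩ := h
  obtain ⟨h0', B', hB', hg'⟩ := h'
  refine ⟨add_nonneg h0 h0', B + B', fun v => ?_, fun y => by simp [hg, hg']⟩
  rw [add_mul]
  exact (norm_add_le _ _).trans (add_le_add (hB v) (hB' v))

theorem HomMaj.sum {ι : Type*} {n : ℕ} (s : Finset ι) {g : ι → E → F} {c : ι → ℝ}
    (h : ∀ i ∈ s, HomMaj n (g i) (c i)) :
    HomMaj n (fun y => ∑ i ∈ s, g i y) (∑ i ∈ s, c i) := by
  classical
  induction s using Finset.induction_on with
  | empty => simpa using HomMaj.zero n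
  | insert a s ha ih =>
    simp only [Finset.sum_insert ha]
    exact (h a (by simp)).add (ih fun i hi => h i (by simp [hi]))

theorem HomMaj.smul {k l n : ℕ} (hn : k + l = n) {a : E → ℝ} {g : E → F} {c c' : ℝ}
    (h : HomMaj k a c) (h' : HomMaj l g c') :
    HomMaj n (fun y => a y • g y) (c * c') := by
  subst hn
  obtain ⟨h0, A, hA, ha⟩ := h
  obtain ⟨h0', B, hB, hg⟩ := h'
  refine ⟨mul_nonneg h0 h0', ((LinearMap.compMultilinearMap
    (TensorProduct.lift (LinearMap.lsmul ℝ F)) (A.domCoprod B)).domDomCongr finSumFinEquiv),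
    fun v => ?_, fun y => ?_⟩
  · simp only [MultilinearMap.domDomCongr_apply, LinearMap.compMultilinearMap_apply,
      MultilinearMap.domCoprod_apply, TensorProduct.lift.tmul, LinearMap.lsmul_apply, norm_smul]
    rw [Fin.prod_univ_add]
    calc _ ≤ (c * ∏ i, ‖v (finSumFinEquiv (Sum.inl i))‖) *
          (c' * ∏ i, ‖v (finSumFinEquiv (Sum.inr i))‖) := by
          gcongr
          · exact hA _
          · exact hB _
      _ = _ := by simp; ring
  · simp [ha, hg]

theorem HomMaj.tsum [CompleteSpace F] {n : ℕ} {g : ℕ → E → F} {c : ℕ → ℝ}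
    (h : ∀ i, HomMaj n (g i) (c i)) (hc : Summable c) :
    HomMaj n (fun y => ∑' i, g i y) (∑' i, c i) := by
  choose h0 B hB hg using h
  let C : ℕ → ContinuousMultilinearMap ℝ (fun _ : Fin n => E) F :=
    fun i => (B i).mkContinuous (c i) (hB i)
  have hC : ∀ i, ‖C i‖ ≤ c i := fun i => (B i).mkContinuous_norm_le (h0 i) (hB i)
  have hs : Summable C := Summable.of_norm_bounded hc hC
  have hs' : Summable (fun i => ‖C i‖) := Summable.of_nonneg_of_le (fun _ => norm_nonneg _) hC hc
  refine ⟨tsum_nonneg h0, (∑' i, C i).toMultilinearMap, fun v => ?_, fun y => ?_⟩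
  · refine ((∑' i, C i).le_opNorm v).trans ?_
    gcongr
    exact (norm_tsum_le_tsum_norm hs').trans (hs'.tsum_le_tsum hC hc)
  · change _ = (∑' i, C i) _
    rw [ContinuousMultilinearMap.tsum_eval hs]
    simp [C, hg]

/-- `g` has an expansion in homogeneous polynomials around `x`, with majorant sum at radius `r`
bounded by `M`. -/
def Maj (g : E → F) (x : E) (r M : ℝ) : Prop :=
  ∃ (G : ℕ → E → F) (c : ℕ → ℝ), (∀ n, HomMaj n (G n) (c n)) ∧
    Summable (fun n => c n * r ^ n) ∧ ∑' n, c n * r ^ n ≤ M ∧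
    ∀ y, ‖y‖ ≤ r → HasSum (fun n => G n y) (g (x + y))

theorem Maj.mono {g : E → F} {x : E} {r M M' : ℝ} (h : Maj g x r M) (hM : M ≤ M') :
    Maj g x r M' := by
  obtain ⟨G, c, h1, h2, h3, h4⟩ := h
  exact ⟨G, c, h1, h2, h3.trans hM, h4⟩

theorem Maj.congr {g g' : E → F} {x : E} {r M : ℝ} (h : Maj g x r M) (hg : ∀ y, g y = g' y) :
    Maj g' x r M := by
  have : g = g' := funext hg
  exact this ▸ h

theorem Maj.nonneg {g : E → F} {x : E} {r M : ℝ} (hr : 0 ≤ r) (h : Maj g x r M) : 0 ≤ M := by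
  obtain ⟨G, c, h1, h2, h3, h4⟩ := h
  exact (tsum_nonneg fun n => mul_nonneg (h1 n).1 (pow_nonneg hr n)).trans h3

theorem Maj.norm_le {g : E → F} {x : E} {r M : ℝ} (h : Maj g x r M) {y : E}
    (hy : ‖y‖ ≤ r) : ‖g (x + y)‖ ≤ M := by
  obtain ⟨G, c, h1, h2, h3, h4⟩ := h
  refine le_trans ?_ h3
  rw [← (h4 y hy).tsum_eq]
  exact tsum_of_norm_bounded h2.hasSum fun n => (h1 n).norm_le' hy

theorem Maj.of_hom {k : ℕ} {G : E → F} {c : ℝ} (h : HomMaj k G c) (x : E) (r : ℝ) :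
    Maj (fun y => G (y - x)) x r (c * r ^ k) := by
  refine ⟨fun n => if n = k then G else fun _ => 0, fun n => if n = k then c else 0, fun n => ?_,
    ?_, ?_, fun y _ => ?_⟩
  · dsimp only
    split_ifs with hn
    · subst hn; exact h
    · exact HomMaj.zero n
  · refine summable_of_ne_finset_zero (s := {k}) fun n hn => ?_
    simp at hn
    simp [hn]
  · rw [tsum_eq_single k]
    · simp
    · intro n hn; simp [hn]
  · have := hasSum_single (f := fun n => (if n = k then G else fun _ => 0) y) k
      (fun n hn => by simp [hn])
    simpa using this

theorem Maj.const (a : F) (x : E) (r : ℝ) : Maj (fun _ : E => a) x r ‖a‖ := by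
  have : HomMaj 0 (fun _ : E => a) ‖a‖ :=
    ⟨norm_nonneg _, MultilinearMap.constOfIsEmpty ℝ _ a, by simp, by simp⟩
  simpa using Maj.of_hom this x r

theorem Maj.add {g g' : E → F} {x : E} {r M M' : ℝ} (h : Maj g x r M) (h' : Maj g' x r M') :
    Maj (fun y => g y + g' y) x r (M + M') := by
  obtain ⟨G, c, h1, h2, h3, h4⟩ := h
  obtain ⟨G', c', h1', h2', h3', h4'⟩ := h'
  refine ⟨fun n y => G n y + G' n y, fun n => c n + c' n, fun n => (h1 n).add (h1' n), ?_, ?_,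
    fun y hy => (h4 y hy).add (h4' y hy)⟩
  · simp only [add_mul]; exact h2.add h2'
  · simp only [add_mul]; rw [h2.tsum_add h2']; exact add_le_add h3 h3'

theorem Maj.sum {ι : Type*} (s : Finset ι) {g : ι → E → F} {x : E} {r : ℝ} {M : ι → ℝ}
    (h : ∀ i ∈ s, Maj (g i) x r (M i)) :
    Maj (fun y => ∑ i ∈ s, g i y) x r (∑ i ∈ s, M i) := by
  classical
  induction s using Finset.induction_on with
  | empty => simpa using Maj.const (0 : F) x r
  | insert a s ha ih =>
    simp only [Finset.sum_insert ha]
    exact (h a (by simp)).add (ih fun i hi => h i (by simp [hi]))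

theorem hasSum_antidiag {u : ℕ × ℕ → F} {v : F} (hp : HasSum u v) :
    HasSum (fun n => ∑ kl ∈ Finset.HasAntidiagonal.antidiagonal n, u kl) v := by
  have := (Finset.HasAntidiagonal.sigmaAntidiagonalEquivProd (A := ℕ)).hasSum_iff.2 hp
  refine this.sigma (g := fun n => ∑ kl ∈ Finset.HasAntidiagonal.antidiagonal n, u kl)
      fun n => ?_
  have h5 := hasSum_fintype
    (fun kl : ↥(Finset.HasAntidiagonal.antidiagonal n) => u (kl : ℕ × ℕ))
  rw [Finset.sum_coe_sort (Finset.HasAntidiagonal.antidiagonal n) u] at h5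
  exact h5

theorem Maj.smul [CompleteSpace F] {a : E → ℝ} {g : E → F} {x : E} {r M M' : ℝ} (hr : 0 ≤ r)
    (h : Maj a x r M) (h' : Maj g x r M') :
    Maj (fun y => a y • g y) x r (M * M') := by
  have hM := h.nonneg hr
  obtain ⟨G, c, h1, h2, h3, h4⟩ := h
  obtain ⟨G', c', h1', h2', h3', h4'⟩ := h'
  have e1 : ∀ n, 0 ≤ c n * r ^ n := fun n => mul_nonneg (h1 n).1 (pow_nonneg hr n)
  have e1' : ∀ n, 0 ≤ c' n * r ^ n := fun n => mul_nonneg (h1' n).1 (pow_nonneg hr n)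
  have key : ∀ n, (∑ kl ∈ Finset.HasAntidiagonal.antidiagonal n, c kl.1 * c' kl.2) * r ^ n =
      ∑ kl ∈ Finset.HasAntidiagonal.antidiagonal n, (c kl.1 * r ^ kl.1) * (c' kl.2 * r ^ kl.2) := by
    intro n
    rw [Finset.sum_mul]
    refine Finset.sum_congr rfl fun kl hkl => ?_
    rw [← Finset.HasAntidiagonal.mem_antidiagonal.1 hkl, pow_add]; ring
  have hprod : Summable (fun z : ℕ × ℕ => (c z.1 * r ^ z.1) * (c' z.2 * r ^ z.2)) :=
    h2.mul_of_nonneg h2' e1 e1'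
  refine ⟨fun n y => ∑ kl ∈ Finset.HasAntidiagonal.antidiagonal n, G kl.1 y • G' kl.2 y,
    fun n => ∑ kl ∈ Finset.HasAntidiagonal.antidiagonal n, c kl.1 * c' kl.2, fun n => ?_, ?_, ?_, fun y hy => ?_⟩
  · exact HomMaj.sum _ fun kl hkl => (h1 _).smul (Finset.HasAntidiagonal.mem_antidiagonal.1 hkl) (h1' _)
  · simp only [key]
    exact summable_sum_mul_antidiagonal_of_summable_mul (f := fun n => c n * r ^ n)
      (g := fun n => c' n * r ^ n) hprod
  · simp only [key]
    rw [← Summable.tsum_mul_tsum_eq_tsum_sum_antidiagonal (f := fun n => c n * r ^ n)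
      (g := fun n => c' n * r ^ n) h2 h2' hprod]
    exact mul_le_mul h3 h3' (tsum_nonneg e1') hM
  · have hs : Summable (fun z : ℕ × ℕ => G z.1 y • G' z.2 y) := by
      refine Summable.of_norm_bounded hprod fun z => ?_
      rw [norm_smul]
      exact mul_le_mul ((h1 _).norm_le' hy) ((h1' _).norm_le' hy) (norm_nonneg _) (e1 _)
    have hp : HasSum (fun z : ℕ × ℕ => G z.1 y • G' z.2 y) (a (x + y) • g (x + y)) :=
      HasSum.smul (f := fun n => G n y) (g := fun n => G' n y) (h4 y hy) (h4' y hy) hs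
    exact hasSum_antidiag hp

theorem Maj.tsum [CompleteSpace F] {g : ℕ → E → F} {x : E} {r : ℝ} {M : ℕ → ℝ} (hr : 0 < r)
    (h : ∀ i, Maj (g i) x r (M i)) (hM : Summable M) :
    Maj (fun y => ∑' i, g i y) x r (∑' i, M i) := by
  choose G c h1 h2 h3 h4 using h
  have e1 : ∀ i n, 0 ≤ c i n * r ^ n := fun i n => mul_nonneg (h1 i n).1 (pow_nonneg hr.le n)
  have hS : Summable (fun z : ℕ × ℕ => c z.1 z.2 * r ^ z.2) := by
    rw [summable_prod_of_nonneg (fun z => e1 _ _)]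
    exact ⟨h2, Summable.of_nonneg_of_le (fun i => tsum_nonneg (e1 i)) h3 hM⟩
  have hS' : Summable (fun z : ℕ × ℕ => c z.2 z.1 * r ^ z.1) := hS.prod_symm
  have hcn : ∀ n, Summable (fun i => c i n) := fun n => by
    have := (hS'.prod_factor n).mul_right ((r ^ n)⁻¹)
    refine this.congr fun i => ?_
    have : r ^ n ≠ 0 := (pow_pos hr n).ne'
    field_simp
  have hmul : ∀ n, (∑' i, c i n) * r ^ n = ∑' i, c i n * r ^ n := fun n => tsum_mul_right.symm
  refine ⟨fun n y => ∑' i, G i n y, fun n => ∑' i, c i n, fun n =>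
    HomMaj.tsum (fun i => h1 i n) (hcn n), ?_, ?_, fun y hy => ?_⟩
  · simp only [hmul]; exact hS'.prod
  · simp only [hmul]
    rw [Summable.tsum_comm (f := fun i n => c i n * r ^ n) hS]
    exact hS.prod.tsum_le_tsum h3 hM
  · have hG : Summable (fun z : ℕ × ℕ => G z.2 z.1 y) :=
      Summable.of_norm_bounded hS' fun z => (h1 _ _).norm_le' hy
    have e : ∑' i, g i (x + y) = ∑' n, ∑' i, G i n y := by
      rw [Summable.tsum_comm (f := fun i n => G i n y) hG.prod_symm]
      exact tsum_congr fun i => (h4 i y hy).tsum_eq.symm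
    change HasSum _ (∑' i, g i (x + y))
    rw [e]
    exact hG.prod.hasSum

theorem Maj.pow {q : E → ℝ} {x : E} {r s : ℝ} (hr : 0 ≤ r) (h : Maj q x r s) (j : ℕ) :
    Maj (fun y => q y ^ j) x r (s ^ j) := by
  induction j with
  | zero => simpa using Maj.const (1 : ℝ) x r
  | succ j ih => simpa [pow_succ] using ih.smul hr h

theorem Maj.series {q : E → ℝ} {x : E} {r s : ℝ} (hr : 0 < r) (h : Maj q x r s) {a : ℕ → ℝ}
    (ha : ∀ j, 0 ≤ a j) (hs : Summable (fun j => a j * s ^ j)) :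
    Maj (fun y => ∑' j, a j * q y ^ j) x r (∑' j, a j * s ^ j) := by
  refine Maj.tsum hr (fun j => ?_) hs
  have := (Maj.const (a j) x r).smul hr.le (h.pow hr.le j)
  simpa [abs_of_nonneg (ha j)] using this

theorem Maj.exp {q : E → ℝ} {x : E} {r s : ℝ} (hr : 0 < r) (h : Maj q x r s) :
    Maj (fun y => Real.exp (q y)) x r (Real.exp s) := by
  have e : ∀ t : ℝ, Real.exp t = ∑' j : ℕ, ((j.factorial : ℝ)⁻¹) * t ^ j := fun t => by
    rw [Real.exp_eq_exp_ℝ, NormedSpace.exp_eq_tsum ℝ]; simp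
  have hs : Summable (fun j : ℕ => ((j.factorial : ℝ)⁻¹) * s ^ j) := by
    simpa [div_eq_inv_mul] using Real.summable_pow_div_factorial s
  have := h.series hr (a := fun j : ℕ => ((j.factorial : ℝ)⁻¹)) (fun j => by positivity) hs
  rw [e s]
  exact this.congr fun y => (e _).symm

theorem Maj.prod {ι : Type*} (s : Finset ι) {g : ι → E → ℝ} {x : E} {r : ℝ} {M : ι → ℝ}
    (hr : 0 ≤ r) (h : ∀ i ∈ s, Maj (g i) x r (M i)) :
    Maj (fun y => ∏ i ∈ s, g i y) x r (∏ i ∈ s, M i) := by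
  classical
  induction s using Finset.induction_on with
  | empty => simpa using Maj.const (1 : ℝ) x r
  | insert a s ha ih =>
    simp only [Finset.prod_insert ha]
    exact (h a (by simp)).smul hr (ih fun i hi => h i (by simp [hi]))

theorem Maj.analyticAt {g : E → F} {x : E} {r M : ℝ} (hr : 0 < r) (h : Maj g x r M) :
    AnalyticAt ℝ g x := by
  obtain ⟨G, c, h1, h2, h3, h4⟩ := h
  choose h0 B hB hg using h1
  let p : FormalMultilinearSeries ℝ E F := fun n => (B n).mkContinuous (c n) (hB n)
  have hp : ∀ n, ‖p n‖ ≤ c n := fun n => (B n).mkContinuous_norm_le (h0 n) (hB n)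
  refine ⟨p, ENNReal.ofReal r, ?_, by simpa using hr, fun {y} hy => ?_⟩
  · have : ((NNReal.mk r hr.le : NNReal) : ENNReal) ≤ p.radius := by
      apply FormalMultilinearSeries.le_radius_of_summable
      refine Summable.of_nonneg_of_le (fun n => by positivity) (fun n => ?_) h2
      have := hp n
      simp only [NNReal.coe_mk]
      gcongr
    rwa [ENNReal.ofReal_eq_coe_nnreal hr.le]
  · have hy' : ‖y‖ ≤ r := by
      rw [Metric.mem_eball, edist_zero_right, ← ofReal_norm, ENNReal.ofReal_lt_ofReal_iff hr] at hy
      exact hy.le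
    have := h4 y hy'
    simpa [p, hg] using this

/-- Re-expansion of a homogeneous polynomial. -/
theorem HomMaj.maj_sub {n : ℕ} {G : E → F} {c : ℝ} (h : HomMaj n G c) (x a : E) (r : ℝ) :
    Maj (fun y => G (y - a) - G (x - a)) x r (c * ((‖x - a‖ + r) ^ n - ‖x - a‖ ^ n)) := by
  classical
  obtain ⟨h0, B, hB, hg⟩ := h
  set z := x - a with hz
  have hs : ∀ s : Finset (Fin n), HomMaj s.card (fun y => B.restr s rfl z (fun _ => y))
      (c * ‖z‖ ^ (n - s.card)) := fun s =>
    ⟨by positivity, B.restr s rfl z, fun v => by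
      exact B.restr_norm_le s rfl z hB v, fun _ => rfl⟩
  have hsum := Maj.sum ((Finset.univ : Finset (Finset (Fin n))).erase ∅)
    (fun s _ => Maj.of_hom (hs s) x r)
  have e1 : ∀ y, B (fun _ => y - a) = ∑ s : Finset (Fin n), B.restr s rfl z (fun _ => y - x) := by
    intro y
    have : (fun _ : Fin n => y - a) = (fun _ => y - x) + (fun _ => z) := by
      ext; simp [hz]
    rw [this, B.map_add_univ]
    refine Finset.sum_congr rfl fun s _ => ?_
    simp only [MultilinearMap.restr, MultilinearMap.coe_mk]
    congr 1
  have e2 : ∀ v, B.restr (∅ : Finset (Fin n)) rfl z v = B (fun _ => z) := by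
    intro v
    change B _ = _
    simp
  refine (hsum.mono (le_of_eq ?_)).congr fun y => ?_
  · have := Fin.sum_pow_mul_eq_add_pow (n := n) r ‖z‖
    rw [add_comm ‖z‖ r, ← this, ← Finset.add_sum_erase _ _ (Finset.mem_univ ∅)]
    simp only [Finset.card_empty, pow_zero, one_mul, Nat.sub_zero, add_sub_cancel_left,
      Finset.mul_sum]
    refine Finset.sum_congr rfl fun s _ => by ring
  · rw [hg, hg, e1 y, ← Finset.add_sum_erase _ _ (Finset.mem_univ ∅)]
    rw [e2]
    simp

end KZ


/-- Coefficients of a truncated exponential. -/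
noncomputable def rCoef (K : ℝ) (j : ℕ) : ℝ := if K ≤ j then K ^ j / j.factorial else 0

/-- Tail of the exponential series of `K * t`, starting from the index `K`. -/
noncomputable def rFun (K t : ℝ) : ℝ := ∑' j, rCoef K j * t ^ j

/-- The analytic step function (a Poisson tail). -/
noncomputable def xiFun (K t : ℝ) : ℝ := Real.exp (-(K * t)) * rFun K t

theorem hasSum_exp_series (t : ℝ) :
    HasSum (fun j : ℕ => t ^ j / j.factorial) (Real.exp t) := by
  rw [Real.exp_eq_exp_ℝ]
  exact NormedSpace.expSeries_div_hasSum_exp t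

theorem rCoef_nonneg {K : ℝ} (hK : 0 ≤ K) (j : ℕ) : 0 ≤ rCoef K j := by
  unfold rCoef; split_ifs <;> positivity

theorem rCoef_mul_le {K t : ℝ} (hK : 0 ≤ K) (ht : 0 ≤ t) (j : ℕ) :
    rCoef K j * t ^ j ≤ (K * t) ^ j / j.factorial := by
  unfold rCoef
  split_ifs
  · rw [mul_pow]; apply le_of_eq; ring
  · rw [zero_mul]; positivity

theorem summable_rCoef {K t : ℝ} (hK : 0 ≤ K) (ht : 0 ≤ t) :
    Summable (fun j => rCoef K j * t ^ j) :=
  Summable.of_nonneg_of_le (fun j => mul_nonneg (rCoef_nonneg hK j) (pow_nonneg ht j))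
    (rCoef_mul_le hK ht) (hasSum_exp_series (K * t)).summable

theorem rFun_nonneg {K t : ℝ} (hK : 0 ≤ K) (ht : 0 ≤ t) : 0 ≤ rFun K t :=
  tsum_nonneg (fun j => mul_nonneg (rCoef_nonneg hK j) (pow_nonneg ht j))

theorem rFun_le_exp {K t : ℝ} (hK : 0 ≤ K) (ht : 0 ≤ t) : rFun K t ≤ Real.exp (K * t) := by
  rw [← (hasSum_exp_series (K * t)).tsum_eq]
  exact (summable_rCoef hK ht).tsum_le_tsum (rCoef_mul_le hK ht) (hasSum_exp_series _).summable

theorem rFun_le_small {K t : ℝ} (hK : 0 ≤ K) (ht : 0 ≤ t) :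
    rFun K t ≤ Real.exp (-K + 3 * (K * t)) := by
  have h := (hasSum_exp_series (3 * (K * t))).mul_left (Real.exp (-K))
  rw [← Real.exp_add] at h
  rw [← h.tsum_eq]
  refine (summable_rCoef hK ht).tsum_le_tsum (fun j => ?_) h.summable
  unfold rCoef
  split_ifs with hj
  · have h3 : (1 : ℝ) ≤ Real.exp (-K) * 3 ^ j := by
      have e1 : Real.exp (j : ℝ) ≤ 3 ^ j := by
        rw [← Real.exp_one_pow]
        have := Real.exp_one_lt_d9
        exact pow_le_pow_left₀ (Real.exp_pos 1).le (by linarith) j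
      calc (1 : ℝ) ≤ Real.exp (-K + j) := Real.one_le_exp (by linarith)
        _ = Real.exp (-K) * Real.exp j := Real.exp_add _ _
        _ ≤ _ := by gcongr
    calc K ^ j / j.factorial * t ^ j ≤ (Real.exp (-K) * 3 ^ j) * (K ^ j / j.factorial * t ^ j) :=
          le_mul_of_one_le_left (by positivity) h3
      _ = _ := by rw [mul_pow, mul_pow]; ring
  · rw [zero_mul]; positivity

theorem half_le_xiFun {K t : ℝ} (hK : 1 ≤ K) (ht : 4 ≤ t) : 1 / 2 ≤ xiFun K t := by
  have hK0 : 0 ≤ K := by linarith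
  have ht0 : 0 ≤ t := by linarith
  have h := (hasSum_exp_series (K * t / 2)).mul_left (Real.exp K)
  rw [← Real.exp_add] at h
  have h1 : Real.exp (K * t) ≤ rFun K t + Real.exp (K + K * t / 2) := by
    rw [← h.tsum_eq, rFun, ← (summable_rCoef hK0 ht0).tsum_add h.summable,
      ← (hasSum_exp_series (K * t)).tsum_eq]
    refine (hasSum_exp_series (K * t)).summable.tsum_le_tsum (fun j => ?_)
      ((summable_rCoef hK0 ht0).add h.summable)
    unfold rCoef
    split_ifs with hj
    · have : 0 ≤ Real.exp K * ((K * t / 2) ^ j / j.factorial) := by positivity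
      have e : (K * t) ^ j / j.factorial = K ^ j / j.factorial * t ^ j := by
        rw [mul_pow]; ring
      linarith
    · push Not at hj
      have h3 : (2 : ℝ) ^ j ≤ Real.exp K := by
        calc (2 : ℝ) ^ j ≤ (Real.exp 1) ^ j := by
              have := Real.exp_one_gt_d9
              exact pow_le_pow_left₀ (by norm_num) (by linarith) j
          _ = Real.exp j := Real.exp_one_pow j
          _ ≤ _ := Real.exp_le_exp.2 hj.le
      rw [zero_mul, zero_add]
      calc (K * t) ^ j / j.factorial = 2 ^ j * ((K * t / 2) ^ j / j.factorial) := by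
            rw [div_pow]; field_simp
        _ ≤ _ := by gcongr
  have h2 : Real.exp (-(K * t)) * Real.exp (K + K * t / 2) ≤ 1 / 2 := by
    rw [← Real.exp_add]
    have : -(K * t) + (K + K * t / 2) ≤ -1 := by nlinarith
    refine (Real.exp_le_exp.2 this).trans ?_
    rw [Real.exp_neg, one_div]
    have := Real.exp_one_gt_d9
    exact inv_anti₀ (by norm_num) (by linarith)
  have h3 : Real.exp (-(K * t)) * Real.exp (K * t) = 1 := by
    rw [← Real.exp_add]; simp
  have h4 := mul_le_mul_of_nonneg_left h1 (Real.exp_pos (-(K * t))).le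
  rw [h3, mul_add] at h4
  unfold xiFun
  linarith

theorem xiFun_nonneg {K t : ℝ} (hK : 0 ≤ K) (ht : 0 ≤ t) : 0 ≤ xiFun K t :=
  mul_nonneg (Real.exp_pos _).le (rFun_nonneg hK ht)

theorem xiFun_le_one {K t : ℝ} (hK : 0 ≤ K) (ht : 0 ≤ t) : xiFun K t ≤ 1 := by
  have := mul_le_mul_of_nonneg_left (rFun_le_exp hK ht) (Real.exp_pos (-(K * t))).le
  rw [← Real.exp_add] at this
  simpa [xiFun] using this

/-- The majorant of the step function. -/
noncomputable def xiB (K t τ : ℝ) : ℝ := Real.exp (K * (τ - t)) * rFun K (t + τ)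

theorem xiB_nonneg {K t τ : ℝ} (hK : 0 ≤ K) (ht : 0 ≤ t) (hτ : 0 ≤ τ) : 0 ≤ xiB K t τ :=
  mul_nonneg (Real.exp_pos _).le (rFun_nonneg hK (by linarith))

theorem xiB_le {K t τ : ℝ} (hK : 0 ≤ K) (ht : 0 ≤ t) (hτ : 0 ≤ τ) :
    xiB K t τ ≤ Real.exp (2 * (K * τ)) := by
  have := mul_le_mul_of_nonneg_left (rFun_le_exp hK (add_nonneg ht hτ))
    (Real.exp_pos (K * (τ - t))).le
  rw [← Real.exp_add] at this
  refine this.trans (le_of_eq ?_)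
  congr 1; ring

theorem xiB_le_small {K t τ : ℝ} (hK : 0 ≤ K) (ht : 0 ≤ t) (hτ : 0 ≤ τ) (ht' : t ≤ 1 / 4)
    (hτ' : τ ≤ 1 / 16) : xiB K t τ ≤ Real.exp (-(K / 4)) := by
  have := mul_le_mul_of_nonneg_left (rFun_le_small hK (add_nonneg ht hτ))
    (Real.exp_pos (K * (τ - t))).le
  rw [← Real.exp_add] at this
  refine this.trans (Real.exp_le_exp.2 ?_)
  nlinarith

section KZ2
variable {E : Type*} [NormedAddCommGroup E] [NormedSpace ℝ E]

theorem Maj.exp_neg {q : E → ℝ} {x : E} {r τ : ℝ} (hr : 0 < r)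
    (h : Maj (fun y => q y - q x) x r τ) {κ : ℝ} (hκ : 0 ≤ κ) :
    Maj (fun y => Real.exp (-(κ * q y))) x r (Real.exp (κ * (τ - q x))) := by
  have h1 := ((Maj.const (-κ) x r).smul hr.le h).exp hr
  have h2 := (Maj.const (Real.exp (-(κ * q x))) x r).smul hr.le h1
  refine (h2.mono (le_of_eq ?_)).congr fun y => ?_
  · rw [Real.norm_eq_abs, Real.norm_eq_abs, abs_of_pos (Real.exp_pos _), abs_neg, abs_of_nonneg hκ,
      ← Real.exp_add]
    congr 1; ring
  · simp only [smul_eq_mul]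
    rw [← Real.exp_add]
    congr 1; ring

theorem Maj.xi {q : E → ℝ} {x : E} {r τ : ℝ} (hr : 0 < r) (hq : 0 ≤ q x)
    (h : Maj (fun y => q y - q x) x r τ) {K : ℝ} (hK : 0 ≤ K) :
    Maj (fun y => xiFun K (q y)) x r (xiB K (q x) τ) := by
  have h1 : Maj q x r (q x + τ) := by
    refine (((Maj.const (q x) x r).add h).mono (le_of_eq ?_)).congr fun y => by ring
    rw [Real.norm_eq_abs, abs_of_nonneg hq]
  have h2 := h1.series hr (rCoef_nonneg hK)
    (summable_rCoef hK (add_nonneg hq (h.nonneg hr.le)))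
  exact (h.exp_neg hr hK).smul hr.le h2

end KZ2

theorem exists_weights (A : ℕ → ℝ) (hA : ∀ n, 0 ≤ A n) :
    ∃ b : ℕ → ℝ, (∀ n, 0 < b n) ∧ Antitone b ∧
      ∀ i N n, i < N → N ≤ n → ∑ l ∈ Finset.Ico N n, b l * A l ≤ b i / 32 := by
  let b : ℕ → ℝ := fun n => ∏ l ∈ Finset.range (n + 1), 1 / (64 * (1 + A l))
  have hb : ∀ n, 0 < b n := fun n => Finset.prod_pos fun l _ => by
    have := hA l; positivity
  have hstep : ∀ n, b (n + 1) * (64 * (1 + A (n + 1))) = b n := fun n => by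
    have := hA (n + 1)
    have h0 : (64 * (1 + A (n + 1))) ≠ 0 := by positivity
    simp only [b]
    rw [Finset.prod_range_succ _ (n + 1), mul_assoc, one_div, inv_mul_cancel₀ h0, mul_one]
  have hanti : Antitone b := antitone_nat_of_succ_le fun n => by
    have := hstep n; have := hb (n + 1); have := hA (n + 1)
    nlinarith [mul_nonneg (hb (n + 1)).le (hA (n + 1))]
  refine ⟨b, hb, hanti, fun i N n hi hN => ?_⟩
  obtain ⟨N, rfl⟩ : ∃ N', N = N' + 1 := ⟨N - 1, by omega⟩
  have key : ∀ d, ∑ l ∈ Finset.Ico (N + 1) (N + 1 + d), b l * A l ≤ (b N - b (N + d)) / 32 := by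
    intro d
    induction d with
    | zero => simp
    | succ d ih =>
      rw [← add_assoc, Finset.sum_Ico_succ_top (by omega)]
      have h1 := hstep (N + d)
      have h2 := hb (N + d + 1)
      have e : N + 1 + d = N + d + 1 := by ring
      have e' : N + (d + 1) = N + d + 1 := by ring
      have h3 := mul_nonneg h2.le (hA (N + d + 1))
      rw [e'] 
      rw [e] at ih ⊢
      nlinarith
  obtain ⟨d, rfl⟩ := Nat.exists_eq_add_of_le hN
  have h1 := key d
  have h2 := hb (N + d)
  have h3 := hanti (show i ≤ N by omega)
  linarith


section KZ3
variable {E Y : Type*} [NormedAddCommGroup E] [NormedSpace ℝ E]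
  [NormedAddCommGroup Y] [NormedSpace ℝ Y]

/-- The bump functions. -/
noncomputable def bump (q : ℕ → E → ℝ) (b lam M : ℕ → ℝ) (n : ℕ) (y : E) : ℝ :=
  Real.exp (8 * lam n) * (Real.exp (-(lam n * q n y)) *
    ∏ i ∈ Finset.range n, xiFun (M n * b i) (q i y))

theorem bump_nonneg {q : ℕ → E → ℝ} {b lam M : ℕ → ℝ} (hq0 : ∀ n y, 0 ≤ q n y)
    (hb : ∀ n, 0 < b n) (hM : ∀ n, 0 ≤ M n) (n : ℕ) (y : E) : 0 ≤ bump q b lam M n y := by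
  unfold bump
  have : 0 ≤ ∏ i ∈ Finset.range n, xiFun (M n * b i) (q i y) :=
    Finset.prod_nonneg fun i _ => xiFun_nonneg (mul_nonneg (hM n) (hb i).le) (hq0 i y)
  positivity

/-- Local summability of the majorants of the bump functions. -/
theorem bump_maj {q : ℕ → E → ℝ} {τ : ℕ → E → ℝ → ℝ} {A b lam M : ℕ → ℝ} {w : ℕ → ℝ}
    (hq0 : ∀ n y, 0 ≤ q n y) (hcov : ∀ x, ∃ i, q i x < 1 / 4)
    (hmaj : ∀ n x r, 0 < r → Maj (fun y => q n y - q n x) x r (τ n x r))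
    (hτ0 : ∀ n x, Tendsto (τ n x) (𝓝[>] 0) (𝓝 0))
    (hτA : ∀ (n : ℕ) x r, ‖x‖ ≤ n → 0 < r → r ≤ 1 → τ n x r ≤ A n)
    (hb : ∀ n, 0 < b n)
    (hbA : ∀ i N n, i < N → N ≤ n → ∑ l ∈ Finset.Ico N n, b l * A l ≤ b i / 32)
    (hlam : ∀ n, 0 ≤ lam n) (hw0 : ∀ n, 0 ≤ w n) (hw : ∀ n, w n ≤ Real.exp (lam n))
    (hM0 : ∀ n, 0 ≤ M n) (hM : ∀ n, n * (8 * (lam n * (9 + A n) + n)) ≤ M n)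
    (hA : ∀ n, 0 ≤ A n) (x : E) :
    ∃ r > 0, ∃ β : ℕ → ℝ, (∀ n, 0 ≤ β n) ∧ (∀ n, Maj (bump q b lam M n) x r (β n)) ∧
      Summable (fun n => β n * w n) := by
  obtain ⟨i, hi⟩ := hcov x
  obtain ⟨N1, hN1⟩ := exists_nat_ge ‖x‖
  set N := max (i + 1) N1 with hN
  have hiN : i < N := lt_of_lt_of_le (Nat.lt_succ_self i) (le_max_left _ _)
  have hxN : ‖x‖ ≤ N := hN1.trans (by exact_mod_cast le_max_right _ _)
  set sb := ∑ l ∈ Finset.range N, b l with hsb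
  have hsb0 : 0 ≤ sb := Finset.sum_nonneg fun l _ => (hb l).le
  set δ := min (1 / 16) (b i / (32 * (1 + sb))) with hδ
  have hδ0 : 0 < δ := by
    have := hb i
    exact lt_min (by norm_num) (by positivity)
  have hev : ∀ᶠ r in 𝓝[>] (0 : ℝ), ∀ l ∈ Finset.range N, τ l x r ≤ δ := by
    rw [Filter.eventually_all_finset]
    intro l _
    exact ((hτ0 l x).eventually (gt_mem_nhds hδ0)).mono fun r hr => hr.le
  have hev1 : ∀ᶠ r in 𝓝[>] (0 : ℝ), r ≤ 1 :=
    (eventually_nhdsWithin_of_eventually_nhds (gt_mem_nhds one_pos)).mono fun r hr => hr.le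
  obtain ⟨r, ⟨hrδ, hr1⟩, hr0⟩ := ((hev.and hev1).and self_mem_nhdsWithin).exists
  have hr0 : 0 < r := hr0
  have hτn : ∀ l, 0 ≤ τ l x r := fun l => (hmaj l x r hr0).nonneg hr0.le
  let β : ℕ → ℝ := fun n => Real.exp (8 * lam n) * (Real.exp (lam n * (τ n x r - q n x)) *
    ∏ l ∈ Finset.range n, xiB (M n * b l) (q l x) (τ l x r))
  have hK : ∀ n l, 0 ≤ M n * b l := fun n l => mul_nonneg (hM0 n) (hb l).le
  have hβ0 : ∀ n, 0 ≤ β n := fun n => by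
    have : 0 ≤ ∏ l ∈ Finset.range n, xiB (M n * b l) (q l x) (τ l x r) :=
      Finset.prod_nonneg fun l _ => xiB_nonneg (hK n l) (hq0 l x) (hτn l)
    simp only [β]; positivity
  refine ⟨r, hr0, β, hβ0, fun n => ?_, ?_⟩
  · have h1 := (hmaj n x r hr0).exp_neg hr0 (hlam n)
    have h2 := Maj.prod (Finset.range n) hr0.le
      (fun l _ => (hmaj l x r hr0).xi hr0 (hq0 l x) (hK n l))
    have h3 := (Maj.const (Real.exp (8 * lam n)) x r).smul hr0.le (h1.smul hr0.le h2)
    rw [Real.norm_eq_abs, abs_of_pos (Real.exp_pos _)] at h3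
    exact h3
  -- summability
  have hsum : ∀ n, N ≤ n → ∑ l ∈ Finset.range n, 2 * (b l * τ l x r) ≤ b i / 8 := by
    intro n hn
    rw [← Finset.sum_range_add_sum_Ico _ hn]
    have e1 : ∑ l ∈ Finset.range N, 2 * (b l * τ l x r) ≤ 2 * (sb * δ) := by
      rw [hsb, Finset.sum_mul, Finset.mul_sum]
      refine Finset.sum_le_sum fun l hl => ?_
      have := mul_le_mul_of_nonneg_left (hrδ l hl) (hb l).le
      linarith
    have e2 : ∑ l ∈ Finset.Ico N n, 2 * (b l * τ l x r) ≤ 2 * (b i / 32) := by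
      refine le_trans ?_ (mul_le_mul_of_nonneg_left (hbA i N n hiN hn) (by norm_num))
      rw [Finset.mul_sum]
      refine Finset.sum_le_sum fun l hl => ?_
      have hl' : (N : ℝ) ≤ l := by exact_mod_cast (Finset.mem_Ico.1 hl).1
      have := mul_le_mul_of_nonneg_left (hτA l x r (hxN.trans hl') hr0 hr1) (hb l).le
      linarith
    have e3 : sb * δ ≤ b i / 32 := by
      have : δ ≤ b i / (32 * (1 + sb)) := min_le_right _ _
      calc sb * δ ≤ (1 + sb) * (b i / (32 * (1 + sb))) := by gcongr; linarith
        _ = b i / 32 := by field_simp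
    linarith
  have hprod : ∀ n, N ≤ n → ∏ l ∈ Finset.range n, xiB (M n * b l) (q l x) (τ l x r) ≤
      Real.exp (-(M n * b i / 8)) := by
    intro n hn
    have hin : i ∈ Finset.range n := Finset.mem_range.2 (hiN.trans_le hn)
    calc _ ≤ ∏ l ∈ Finset.range n, Real.exp (2 * (M n * b l * τ l x r) -
          if l = i then M n * b i / 4 else 0) := by
          refine Finset.prod_le_prod (fun l _ => xiB_nonneg (hK n l) (hq0 l x) (hτn l))
            fun l hl => ?_
          split_ifs with hli
          · subst hli
            refine (xiB_le_small (hK n l) (hq0 l x) (hτn l) hi.le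
              ((hrδ l (Finset.mem_range.2 hiN)).trans (min_le_left _ _))).trans ?_
            refine Real.exp_le_exp.2 ?_
            have := mul_nonneg (hK n l) (hτn l)
            linarith
          · simpa using xiB_le (hK n l) (hq0 l x) (hτn l)
      _ = Real.exp (M n * (∑ l ∈ Finset.range n, 2 * (b l * τ l x r)) - M n * b i / 4) := by
          rw [← Real.exp_sum, Finset.sum_sub_distrib, Finset.sum_ite_eq' _ i, if_pos hin,
            Finset.mul_sum]
          congr 2
          exact Finset.sum_congr rfl fun l _ => by ring
      _ ≤ _ := by
          refine Real.exp_le_exp.2 ?_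
          have := mul_le_mul_of_nonneg_left (hsum n hn) (hM0 n)
          linarith
  have hlast : ∀ n : ℕ, N ≤ n → 1 / b i ≤ n → β n * w n ≤ Real.exp (-1 : ℝ) ^ n := by
    intro n hn hnb
    have hτn' : τ n x r ≤ A n := hτA n x r (hxN.trans (by exact_mod_cast hn)) hr0 hr1
    have h1 : lam n * (9 + A n) + n ≤ M n * b i / 8 := by
      have e1 : 1 ≤ n * b i := by rwa [div_le_iff₀ (hb i)] at hnb
      have e2 := mul_le_mul_of_nonneg_right (hM n) (hb i).le
      have e3 : 0 ≤ lam n * (9 + A n) + n := by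
        have := hlam n; have := hA n; positivity
      nlinarith
    rw [← Real.exp_nat_mul]
    calc β n * w n ≤ (Real.exp (8 * lam n) * (Real.exp (lam n * A n) *
          Real.exp (-(M n * b i / 8)))) * Real.exp (lam n) := by
          refine mul_le_mul ?_ (hw n) (hw0 n) (by positivity)
          refine mul_le_mul_of_nonneg_left ?_ (Real.exp_pos _).le
          refine mul_le_mul ?_ (hprod n hn) (Finset.prod_nonneg fun l _ =>
            xiB_nonneg (hK n l) (hq0 l x) (hτn l)) (Real.exp_pos _).le
          refine Real.exp_le_exp.2 (mul_le_mul_of_nonneg_left ?_ (hlam n))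
          linarith [hq0 n x]
      _ = Real.exp (8 * lam n + (lam n * A n + -(M n * b i / 8)) + lam n) := by
          rw [Real.exp_add, Real.exp_add, Real.exp_add]
      _ ≤ _ := Real.exp_le_exp.2 (by linarith)
  obtain ⟨N2, hN2⟩ := exists_nat_ge (1 / b i)
  refine Summable.of_norm_bounded_eventually_nat (g := fun n : ℕ => Real.exp (-1 : ℝ) ^ n)
    (summable_geometric_of_lt_one (Real.exp_pos _).le (by simp)) ?_
  filter_upwards [eventually_ge_atTop N, eventually_ge_atTop N2] with n hn hn2
  rw [Real.norm_eq_abs, abs_of_nonneg (mul_nonneg (hβ0 n) (hw0 n))]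
  exact hlast n hn (hN2.trans (by exact_mod_cast hn2))

theorem kz_core [CompleteSpace Y] (f : E → Y) {ε : ℝ} (hε : 0 < ε) (v : ℕ → Y)
    {q : ℕ → E → ℝ} {τ : ℕ → E → ℝ → ℝ} {A : ℕ → ℝ}
    (hq0 : ∀ n y, 0 ≤ q n y) (hcov : ∀ x, ∃ i, q i x < 1 / 4)
    (hclose : ∀ n y, q n y < 12 → ‖f y - v n‖ ≤ ε / 2)
    (hmaj : ∀ n x r, 0 < r → Maj (fun y => q n y - q n x) x r (τ n x r))
    (hτ0 : ∀ n x, Tendsto (τ n x) (𝓝[>] 0) (𝓝 0)) (hA : ∀ n, 0 ≤ A n)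
    (hτA : ∀ (n : ℕ) x r, ‖x‖ ≤ n → 0 < r → r ≤ 1 → τ n x r ≤ A n) :
    ∃ h : E → Y, (∀ x, AnalyticAt ℝ h x) ∧ ∀ x, ‖f x - h x‖ < ε := by
  obtain ⟨b, hb, hbanti, hbA⟩ := exists_weights A hA
  let lam : ℕ → ℝ := fun n => n + ‖v n‖ + (16 / ε + 4)
  have hC0 : 0 < 16 / ε + 4 := by positivity
  have hlam : ∀ n, 0 ≤ lam n := fun n => by simp only [lam]; positivity
  let M : ℕ → ℝ := fun n => n * (8 * (lam n * (9 + A n) + n)) + 1 / b n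
  have hM1 : ∀ n : ℕ, 0 ≤ (n : ℝ) * (8 * (lam n * (9 + A n) + n)) := fun n => by
    have := hlam n; have := hA n; positivity
  have hM : ∀ n : ℕ, n * (8 * (lam n * (9 + A n) + n)) ≤ M n := fun n => by
    have := hb n
    simp only [M]
    have : 0 < 1 / b n := by positivity
    linarith
  have hM0 : ∀ n, 0 ≤ M n := fun n => (hM1 n).trans (hM n)
  have hK1 : ∀ n i, i ≤ n → 1 ≤ M n * b i := fun n i hi => by
    have h1 : 1 / b n ≤ M n := by simp only [M]; linarith [hM1 n]
    have h2 := hbanti hi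
    calc (1 : ℝ) = 1 / b n * b n := by have := hb n; field_simp
      _ ≤ M n * b i := mul_le_mul h1 h2 (hb n).le (hM0 n)
  have hw : ∀ n, 1 + ‖v n‖ ≤ Real.exp (lam n) := fun n => by
    have := Real.add_one_le_exp (lam n)
    have : (0 : ℝ) ≤ n := n.cast_nonneg
    simp only [lam] at *
    linarith
  set φ := bump q b lam M with hφ
  have hφ0 : ∀ n y, 0 ≤ φ n y := bump_nonneg hq0 hb hM0
  have hloc := bump_maj hq0 hcov hmaj hτ0 hτA hb hbA hlam (w := fun n => 1 + ‖v n‖)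
    (fun n => by positivity) hw hM0 hM hA
  let S : E → ℝ := fun y => ∑' n, φ n y
  let T : E → Y := fun y => ∑' n, φ n y • v n
  have hSan : ∀ x, AnalyticAt ℝ S x := fun x => by
    obtain ⟨r, hr, β, hβ0, hβ, hβs⟩ := hloc x
    refine (Maj.tsum hr hβ (Summable.of_nonneg_of_le hβ0 (fun n => ?_) hβs)).analyticAt hr
    nlinarith [mul_nonneg (hβ0 n) (norm_nonneg (v n))]
  have hTan : ∀ x, AnalyticAt ℝ T x := fun x => by
    obtain ⟨r, hr, β, hβ0, hβ, hβs⟩ := hloc x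
    refine (Maj.tsum hr (fun n => (hβ n).smul hr.le (Maj.const (v n) x r))
      (Summable.of_nonneg_of_le (fun n => mul_nonneg (hβ0 n) (norm_nonneg _))
        (fun n => ?_) hβs)).analyticAt hr
    nlinarith [hβ0 n]
  have hsw : ∀ x, Summable (fun n => φ n x * (1 + ‖v n‖)) := fun x => by
    obtain ⟨r, hr, β, hβ0, hβ, hβs⟩ := hloc x
    refine Summable.of_nonneg_of_le (fun n => mul_nonneg (hφ0 n x) (by positivity))
      (fun n => ?_) hβs
    have := (hβ n).norm_le (y := 0) (by simpa using hr.le)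
    rw [add_zero, Real.norm_eq_abs] at this
    exact mul_le_mul_of_nonneg_right ((le_abs_self _).trans this) (by positivity)
  have hsφ : ∀ x, Summable (fun n => φ n x) := fun x =>
    Summable.of_nonneg_of_le (fun n => hφ0 n x) (fun n => by
      nlinarith [mul_nonneg (hφ0 n x) (norm_nonneg (v n))]) (hsw x)
  have hsv : ∀ x, Summable (fun n => φ n x • v n) := fun x =>
    Summable.of_norm_bounded (hsw x) (fun n => by
      rw [norm_smul, Real.norm_eq_abs, abs_of_nonneg (hφ0 n x)]
      nlinarith [hφ0 n x])
  -- the dominating index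
  have hdom : ∀ x, ∃ m, ‖f x - v m‖ ≤ ε / 2 ∧ Real.exp (lam m) ≤ φ m x := fun x => by
    classical
    have hex : ∃ m, q m x < 4 := by
      obtain ⟨i, hi⟩ := hcov x
      exact ⟨i, by linarith⟩
    refine ⟨Nat.find hex, hclose _ _ (by linarith [Nat.find_spec hex]), ?_⟩
    have hm := Nat.find_spec hex
    have hmin : ∀ i, i < Nat.find hex → 4 ≤ q i x := fun i hi =>
      not_lt.1 (Nat.find_min hex hi)
    set m := Nat.find hex
    have hpr : (1 / 2 : ℝ) ^ m ≤ ∏ i ∈ Finset.range m, xiFun (M m * b i) (q i x) := by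
      have : (1 / 2 : ℝ) ^ m = ∏ i ∈ Finset.range m, (1 / 2 : ℝ) := by simp
      rw [this]
      refine Finset.prod_le_prod (fun _ _ => by norm_num) fun i hi => ?_
      have hi := Finset.mem_range.1 hi
      exact half_le_xiFun (hK1 m i hi.le) (hmin i hi)
    have hhalf : Real.exp (-(m : ℝ)) ≤ (1 / 2 : ℝ) ^ m := by
      have : Real.exp (-(m : ℝ)) = (Real.exp (-1)) ^ m := by
        rw [← Real.exp_nat_mul]; congr 1; ring
      rw [this]
      refine pow_le_pow_left₀ (Real.exp_pos _).le ?_ m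
      rw [Real.exp_neg, one_div]
      have := Real.exp_one_gt_d9
      exact inv_anti₀ (by norm_num) (by linarith)
    have hml : (m : ℝ) ≤ lam m := by
      simp only [lam]
      have := norm_nonneg (v m)
      linarith
    calc Real.exp (lam m) ≤ Real.exp (8 * lam m + (-(lam m * 4) + -(m : ℝ))) :=
          Real.exp_le_exp.2 (by linarith [hlam m])
      _ = Real.exp (8 * lam m) * (Real.exp (-(lam m * 4)) * Real.exp (-(m : ℝ))) := by
          rw [Real.exp_add, Real.exp_add]
      _ ≤ φ m x := by
          refine mul_le_mul_of_nonneg_left ?_ (Real.exp_pos _).le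
          refine mul_le_mul ?_ (hhalf.trans hpr) (Real.exp_pos _).le (Real.exp_pos _).le
          exact Real.exp_le_exp.2 (by nlinarith [hlam m])
  have hSpos : ∀ x, 0 < S x := fun x => by
    obtain ⟨m, -, hm⟩ := hdom x
    exact ((Real.exp_pos _).trans_le hm).trans_le ((hsφ x).le_tsum m fun n _ => hφ0 n x)
  refine ⟨fun y => (S y)⁻¹ • T y, fun x => ((hSan x).inv (hSpos x).ne').smul (hTan x),
    fun x => ?_⟩
  obtain ⟨m, hm1, hm2⟩ := hdom x
  have hbnd : ∀ n, ‖φ n x • (f x - v n)‖ ≤ ε / 2 * φ n x + φ m x * (ε / 8) * (1 / 2) ^ n := by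
    intro n
    rw [norm_smul, Real.norm_eq_abs, abs_of_nonneg (hφ0 n x)]
    have hpm : 0 ≤ φ m x * (ε / 8) * (1 / 2) ^ n := by
      have := hφ0 m x; positivity
    by_cases hn : q n x < 12
    · have := mul_le_mul_of_nonneg_left (hclose n x hn) (hφ0 n x)
      linarith
    · push Not at hn
      have hφn : φ n x ≤ Real.exp (-(4 * lam n)) := by
        calc φ n x ≤ Real.exp (8 * lam n) * (Real.exp (-(lam n * q n x)) * 1) := by
              refine mul_le_mul_of_nonneg_left ?_ (Real.exp_pos _).le
              refine mul_le_mul_of_nonneg_left ?_ (Real.exp_pos _).le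
              exact Finset.prod_le_one
                (fun i _ => xiFun_nonneg (mul_nonneg (hM0 n) (hb i).le) (hq0 i x))
                (fun i _ => xiFun_le_one (mul_nonneg (hM0 n) (hb i).le) (hq0 i x))
          _ = Real.exp (8 * lam n + -(lam n * q n x)) := by rw [mul_one, Real.exp_add]
          _ ≤ _ := Real.exp_le_exp.2 (by nlinarith [hlam n])
      have hd : ‖f x - v n‖ ≤ ε / 2 + ‖v m‖ + ‖v n‖ := by
        calc ‖f x - v n‖ = ‖(f x - v m) + v m - v n‖ := by congr 1; abel
          _ ≤ ‖f x - v m‖ + ‖v m‖ + ‖v n‖ := (norm_sub_le _ _).trans (by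
              gcongr; exact norm_add_le _ _)
          _ ≤ _ := by gcongr
      set a := Real.exp (-lam n) with ha
      have ha0 : 0 < a := Real.exp_pos _
      have ha1 : a ≤ 1 := by rw [ha]; exact Real.exp_le_one_iff.2 (by linarith [hlam n])
      have ha4 : Real.exp (-(4 * lam n)) = a ^ 4 := by
        rw [ha, ← Real.exp_nat_mul]; congr 1; push_cast; ring
      have hav : a * ‖v n‖ ≤ 1 := by
        have h1 : a * Real.exp (lam n) = 1 := by rw [ha, ← Real.exp_add]; simp
        have h2 := hw n
        have h3 : a * ‖v n‖ ≤ a * Real.exp (lam n) :=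
          mul_le_mul_of_nonneg_left (by linarith) ha0.le
        linarith
      have hP : 1 + ‖v m‖ ≤ φ m x := (hw m).trans hm2
      have hae : a * (ε / 2 + 2) ≤ (ε / 8) * (1 / 2) ^ n := by
        have h1 : a ≤ Real.exp (-(n : ℝ)) * Real.exp (-(16 / ε + 4)) := by
          rw [ha, ← Real.exp_add]
          refine Real.exp_le_exp.2 ?_
          simp only [lam]
          linarith [norm_nonneg (v n)]
        have h2 : Real.exp (-(n : ℝ)) ≤ (1 / 2 : ℝ) ^ n := by
          have : Real.exp (-(n : ℝ)) = (Real.exp (-1)) ^ n := by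
            rw [← Real.exp_nat_mul]; congr 1; ring
          rw [this]
          refine pow_le_pow_left₀ (Real.exp_pos _).le ?_ n
          rw [Real.exp_neg, one_div]
          have := Real.exp_one_gt_d9
          exact inv_anti₀ (by norm_num) (by linarith)
        have h3 : Real.exp (-(16 / ε + 4)) * (ε / 2 + 2) ≤ ε / 8 := by
          rw [Real.exp_neg, inv_mul_le_iff₀ (Real.exp_pos _)]
          have h4 := Real.add_one_le_exp (16 / ε + 4)
          have h5 : (16 / ε + 4) * (ε / 8) = ε / 2 + 2 := by field_simp; ring
          rw [← h5]
          refine mul_le_mul_of_nonneg_right (by linarith) (by positivity)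
        calc a * (ε / 2 + 2) ≤ (Real.exp (-(n : ℝ)) * Real.exp (-(16 / ε + 4))) * (ε / 2 + 2) := by
              gcongr
          _ = Real.exp (-(n : ℝ)) * (Real.exp (-(16 / ε + 4)) * (ε / 2 + 2)) := by ring
          _ ≤ (1 / 2) ^ n * (ε / 8) := by gcongr
          _ = _ := by ring
      have hfin : a ^ 4 * (ε / 2 + ‖v m‖ + ‖v n‖) ≤ φ m x * (a * (ε / 2 + 2)) := by
        have hvm := norm_nonneg (v m)
        have hvn := norm_nonneg (v n)
        have hφ1 : 1 ≤ φ m x := by linarith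
        have e1 : a ^ 4 ≤ a := by
          calc a ^ 4 ≤ a ^ 1 := pow_le_pow_of_le_one ha0.le ha1 (by norm_num)
            _ = a := pow_one a
        have e2 : a ^ 4 * ‖v n‖ ≤ a := by
          calc a ^ 4 * ‖v n‖ = a ^ 3 * (a * ‖v n‖) := by ring
            _ ≤ a ^ 3 * 1 := by gcongr
            _ ≤ a ^ 1 := by
              rw [mul_one]; exact pow_le_pow_of_le_one ha0.le ha1 (by norm_num)
            _ = a := pow_one a
        have e3 : a ^ 4 * ‖v m‖ ≤ a * φ m x := mul_le_mul e1 (by linarith) hvm ha0.le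
        have e4 : a ^ 4 * (ε / 2) ≤ φ m x * (a * (ε / 2)) := by
          calc a ^ 4 * (ε / 2) ≤ 1 * (a * (ε / 2)) := by rw [one_mul]; gcongr
            _ ≤ _ := by gcongr
        nlinarith
      calc φ n x * ‖f x - v n‖ ≤ a ^ 4 * (ε / 2 + ‖v m‖ + ‖v n‖) := by
            rw [← ha4]; exact mul_le_mul hφn hd (norm_nonneg _) (Real.exp_pos _).le
        _ ≤ φ m x * (a * (ε / 2 + 2)) := hfin
        _ ≤ φ m x * ((ε / 8) * (1 / 2) ^ n) := mul_le_mul_of_nonneg_left hae (hφ0 m x)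
        _ ≤ _ := by
            have : 0 ≤ ε / 2 * φ n x := mul_nonneg (by linarith) (hφ0 n x)
            linarith
  have hdiff : f x - (S x)⁻¹ • T x = (S x)⁻¹ • ∑' n, φ n x • (f x - v n) := by
    have h1 : ∑' n, φ n x • (f x - v n) = S x • f x - T x := by
      simp only [smul_sub]
      rw [((hsφ x).smul_const (f x)).tsum_sub (hsv x), (hsφ x).tsum_smul_const]
    rw [h1, smul_sub, smul_smul, inv_mul_cancel₀ (hSpos x).ne', one_smul]
  have hgeo : HasSum (fun n : ℕ => φ m x * (ε / 8) * (1 / 2 : ℝ) ^ n) (φ m x * (ε / 8) * 2) :=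
    hasSum_geometric_two.mul_left _
  have htot := tsum_of_norm_bounded (((hsφ x).hasSum.mul_left (ε / 2)).add hgeo) hbnd
  have hmS : φ m x ≤ S x := (hsφ x).le_tsum m fun n _ => hφ0 n x
  rw [hdiff, norm_smul, norm_inv, Real.norm_eq_abs, abs_of_pos (hSpos x),
    inv_mul_lt_iff₀ (hSpos x)]
  refine htot.trans_lt ?_
  change ε / 2 * S x + _ < _
  nlinarith [hSpos x, mul_le_mul_of_nonneg_right hmS hε.le, mul_pos (hSpos x) hε]

end KZ3

section P4
variable {E : Type*} [NormedAddCommGroup E] [NormedSpace ℝ E]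
  {Y : Type*} [NormedAddCommGroup Y] [NormedSpace ℝ Y]

theorem kz_poly [SecondCountableTopology E] [CompleteSpace Y] (f : E → Y) (hf : Continuous f)
    (j : ℕ) (B : (n : ℕ) → MultilinearMap ℝ (fun _ : Fin n => E) ℝ) (C : ℕ → ℝ)
    (hC0 : ∀ n, 0 ≤ C n) (hB : ∀ n v, ‖B n v‖ ≤ C n * ∏ i, ‖v i‖)
    (hP0 : ∑ n ∈ Finset.range (j + 1), B n (fun _ => (0 : E)) = 0)
    (hP1 : ∀ x : E, ‖x‖ = 1 → 1 ≤ |∑ n ∈ Finset.range (j + 1), B n (fun _ => x)|)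
    {ε : ℝ} (hε : 0 < ε) :
    ∃ h : E → Y, (∀ x, AnalyticAt ℝ h x) ∧ ∀ x, ‖f x - h x‖ < ε := by
  classical
  let Q : E → ℝ := fun x => ∑ n ∈ Finset.range (j + 1), B n (fun _ => x) * B n (fun _ => x)
  have hQ0 : ∀ x, 0 ≤ Q x := fun x => Finset.sum_nonneg fun n _ => mul_self_nonneg _
  have hhom : ∀ n, HomMaj (n + n) (fun x : E => B n (fun _ => x) * B n (fun _ => x))
      (C n * C n) := by
    intro n
    have h1 : HomMaj n (fun x : E => B n (fun _ => x)) (C n) :=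
      ⟨hC0 n, B n, hB n, fun y => rfl⟩
    exact HomMaj.smul rfl h1 h1
  have hQz : Q 0 = 0 := by
    have hz : ∀ n, n ≠ 0 → B n (fun _ => (0 : E)) = 0 := by
      intro n hn
      exact (B n).map_coord_zero ⟨0, Nat.pos_of_ne_zero hn⟩ rfl
    have h0 : B 0 (fun _ => (0 : E)) = 0 := by
      rw [Finset.sum_eq_single 0 (fun n _ hn => hz n hn) (by simp)] at hP0
      exact hP0
    refine Finset.sum_eq_zero fun n _ => ?_
    rcases eq_or_ne n 0 with rfl | hn
    · rw [h0]; simp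
    · rw [hz n hn]; simp
  let T : E → E → ℝ → ℝ := fun a x r => ∑ n ∈ Finset.range (j + 1),
    (C n * C n) * ((‖x - a‖ + r) ^ (n + n) - ‖x - a‖ ^ (n + n))
  have hQmaj : ∀ a x r, Maj (fun y => Q (y - a) - Q (x - a)) x r (T a x r) := by
    intro a x r
    refine (Maj.sum (Finset.range (j + 1)) (fun n _ => (hhom n).maj_sub x a r)).congr ?_
    intro y
    simp only [Q, Finset.sum_sub_distrib]
  have hQlow : ∀ x, x ≠ 0 → min 1 ‖x‖ ^ (j + j) ≤ (j + 1) * Q x := by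
    intro x hx
    have ht : 0 < ‖x‖ := norm_pos_iff.2 hx
    let u : E := ‖x‖⁻¹ • x
    have hu : ‖u‖ = 1 := by
      simp only [u, norm_smul, norm_inv, norm_norm]; field_simp
    have hxu : x = ‖x‖ • u := by
      simp only [u, smul_smul]; rw [mul_inv_cancel₀ ht.ne', one_smul]
    have hBu : ∀ n, B n (fun _ => x) = ‖x‖ ^ n * B n (fun _ => u) := by
      intro n
      have := (B n).map_smul_univ (fun _ => ‖x‖) (fun _ => u)
      rw [← hxu] at this
      simpa using this
    have hmn : 0 ≤ min 1 ‖x‖ := le_min zero_le_one ht.le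
    have h1 : 1 ≤ (j + 1) * Q u := by
      have h2 := hP1 u hu
      have h3 := sq_sum_le_card_mul_sum_sq (s := Finset.range (j + 1))
        (f := fun n => B n (fun _ => u))
      have h4 : 1 ≤ (∑ n ∈ Finset.range (j + 1), B n (fun _ => u)) ^ 2 := by
        rw [← sq_abs]; nlinarith
      have h5 : ∑ n ∈ Finset.range (j + 1), (B n (fun _ => u)) ^ 2 = Q u := by
        simp only [Q, sq]
      rw [h5, Finset.card_range] at h3
      push_cast at h3
      linarith
    have h2 : min 1 ‖x‖ ^ (j + j) * Q u ≤ Q x := by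
      simp only [Q, Finset.mul_sum]
      refine Finset.sum_le_sum fun n hn => ?_
      have hn' : n ≤ j := by simpa [Nat.lt_succ_iff] using hn
      rw [hBu]
      have h3 : min 1 ‖x‖ ^ (j + j) ≤ ‖x‖ ^ (n + n) :=
        (pow_le_pow_of_le_one hmn (min_le_left _ _) (by omega)).trans
          (pow_le_pow_left₀ hmn (min_le_right _ _) _)
      have := mul_le_mul_of_nonneg_right h3 (mul_self_nonneg (B n (fun _ => u)))
      refine this.trans (le_of_eq ?_)
      rw [pow_add]; ring
    have h3 : 0 ≤ min 1 ‖x‖ ^ (j + j) := by positivity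
    nlinarith
  have hQsmall : ∀ δ > (0 : ℝ), ∃ η > (0 : ℝ), ∀ z : E, Q z < η → ‖z‖ < δ := by
    intro δ hδ
    refine ⟨min 1 δ ^ (j + j) / (j + 1), by positivity, fun z hz => ?_⟩
    by_contra hcon
    push Not at hcon
    have h1 := hQlow z (norm_pos_iff.1 (hδ.trans_le hcon))
    have h2 : min 1 δ ^ (j + j) ≤ min 1 ‖z‖ ^ (j + j) :=
      pow_le_pow_left₀ (by positivity) (min_le_min_left _ hcon) _
    rw [lt_div_iff₀ (by positivity)] at hz
    nlinarith
  have hQcont : ∀ a, ContinuousAt (fun y => Q (y - a)) a := by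
    intro a
    have h1 := ((hQmaj a a 1).analyticAt one_pos).continuousAt
    simpa using h1.add_const (Q (a - a))
  -- choose scaling
  have hsc : ∀ a : E, ∃ c > (0 : ℝ), ∀ y, c * Q (y - a) < 12 → ‖f y - f a‖ ≤ ε / 2 := by
    intro a
    obtain ⟨δ, hδ, hδf⟩ := Metric.continuousAt_iff.1 (hf.continuousAt (x := a)) (ε / 2)
      (by positivity)
    obtain ⟨η, hη, hηQ⟩ := hQsmall δ hδ
    refine ⟨12 / η, by positivity, fun y hy => ?_⟩
    have h1 : Q (y - a) < η := by
      rw [div_mul_eq_mul_div, div_lt_iff₀ hη] at hy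
      linarith
    have h2 := hδf (x := y) (by rw [dist_eq_norm]; exact hηQ _ h1)
    rw [dist_eq_norm] at h2
    exact h2.le
  choose c hc hcf using hsc
  have hU : ∀ a : E, {y | c a * Q (y - a) < 1 / 4} ∈ 𝓝 a := by
    intro a
    have h1 : ContinuousAt (fun y => c a * Q (y - a)) a := (hQcont a).const_mul _
    refine h1.eventually_lt continuousAt_const ?_
    simp [hQz]
  obtain ⟨s, hs, hsU⟩ := TopologicalSpace.countable_cover_nhds hU
  have hsne : s.Nonempty := by
    by_contra h
    rw [Set.not_nonempty_iff_eq_empty] at h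
    have : (0 : E) ∈ (⋃ x ∈ s, {y | c x * Q (y - x) < 1 / 4}) := by rw [hsU]; trivial
    simp [h] at this
  obtain ⟨a, ha⟩ := hs.exists_eq_range hsne
  refine kz_core f hε (fun n => f (a n)) (q := fun n y => c (a n) * Q (y - a n))
    (τ := fun n x r => ‖c (a n)‖ * T (a n) x r)
    (A := fun n => c (a n) * ∑ m ∈ Finset.range (j + 1), (C m * C m) *
      (n + ‖a n‖ + 1) ^ (m + m)) ?_ ?_ ?_ ?_ ?_ ?_ ?_
  · intro n y
    exact mul_nonneg (hc _).le (hQ0 _)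
  · intro x
    have : x ∈ (⋃ x ∈ s, {y | c x * Q (y - x) < 1 / 4}) := by rw [hsU]; trivial
    simp only [Set.mem_iUnion, Set.mem_ofPred_eq, ha, Set.mem_range] at this
    obtain ⟨_, ⟨i, rfl⟩, hi⟩ := this
    exact ⟨i, hi⟩
  · intro n y hy
    exact hcf _ _ hy
  · intro n x r hr
    refine (Maj.smul hr.le (Maj.const (c (a n)) x r) (hQmaj (a n) x r)).congr ?_
    intro y
    simp only [smul_eq_mul]; ring
  · intro n x
    have h1 : Continuous (fun r => ‖c (a n)‖ * T (a n) x r) := by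
      simp only [T]; fun_prop
    have h2 := (h1.tendsto 0).mono_left (nhdsWithin_le_nhds (s := Set.Ioi 0))
    simpa [T] using h2
  · intro n
    refine mul_nonneg (hc _).le (Finset.sum_nonneg fun m _ => ?_)
    have := hC0 m
    positivity
  · intro n x r hx hr hr1
    rw [Real.norm_of_nonneg (hc _).le]
    refine mul_le_mul_of_nonneg_left (Finset.sum_le_sum fun m _ => ?_) (hc _).le
    refine mul_le_mul_of_nonneg_left ?_ (mul_self_nonneg _)
    have h1 : ‖x - a n‖ + r ≤ n + ‖a n‖ + 1 := by
      have := norm_sub_le x (a n)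
      linarith
    have h2 := pow_le_pow_left₀ (by positivity : 0 ≤ ‖x - a n‖ + r) h1 (m + m)
    have h3 : 0 ≤ ‖x - a n‖ ^ (m + m) := by positivity
    linarith
end P4

theorem frechetDist_small {X : Type*} [AddCommGroup X] [Module ℝ X]
    (p : ℕ → Seminorm ℝ X) (k : ℕ) {δ : ℝ} (hδ : 0 < δ) :
    ∃ η > (0 : ℝ), ∀ x y : X, frechetDist p x y < η → p k (x - y) < δ := by
  refine ⟨(1 / 2 : ℝ) ^ (k + 1) * (δ / (1 + δ)), by positivity, fun x y hxy => ?_⟩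
  by_contra hcon
  push Not at hcon
  have hnn : ∀ n, 0 ≤ (1 / 2 : ℝ) ^ (n + 1) * (p n (x - y) / (1 + p n (x - y))) := fun n => by
    have := apply_nonneg (p n) (x - y)
    positivity
  have hle : ∀ n, (1 / 2 : ℝ) ^ (n + 1) * (p n (x - y) / (1 + p n (x - y)))
      ≤ (1 / 2 : ℝ) ^ (n + 1) := fun n => by
    have := apply_nonneg (p n) (x - y)
    refine mul_le_of_le_one_right (by positivity) ?_
    rw [div_le_one (by positivity)]; linarith
  have hsum : Summable fun n => (1 / 2 : ℝ) ^ (n + 1) * (p n (x - y) / (1 + p n (x - y))) :=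
    Summable.of_nonneg_of_le hnn hle ((summable_nat_add_iff 1).2 summable_geometric_two)
  have h1 := hsum.le_tsum k (fun n _ => hnn n)
  have h2 : δ / (1 + δ) ≤ p k (x - y) / (1 + p k (x - y)) := by
    rw [div_le_div_iff₀ (by positivity) (by linarith)]
    nlinarith
  have h3 := mul_le_mul_of_nonneg_left h2 (by positivity : (0 : ℝ) ≤ (1 / 2 : ℝ) ^ (k + 1))
  unfold frechetDist at hxy
  linarith

theorem seqcont_of_cauchy {X Y : Type*} [AddCommGroup X] [Module ℝ X]
    [NormedAddCommGroup Y] (p : Seminorm ℝ X) (f : X → Y)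
    (hf : ∀ u : ℕ → X,
      (∀ ε > (0:ℝ), ∃ N, ∀ m ≥ N, ∀ n ≥ N, p (u m - u n) < ε) →
      ∃ y : Y, Tendsto (fun n => f (u n)) atTop (𝓝 y)) (x : X) {ε : ℝ} (hε : 0 < ε) :
    ∃ δ > (0 : ℝ), ∀ y, p (y - x) < δ → ‖f y - f x‖ < ε := by
  by_contra hcon
  push Not at hcon
  choose w hw hwf using fun n : ℕ => hcon (1 / (n + 1)) (by positivity)
  let u : ℕ → X := fun n => if Even n then x else w n
  have hu : ∀ n, p (u n - x) ≤ 1 / (n + 1) := by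
    intro n
    by_cases h : Even n
    · simp only [u, h, if_true, sub_self, map_zero]; positivity
    · simp only [u, h, if_false]; exact (hw n).le
  obtain ⟨y, hy⟩ := hf u (by
    intro e he
    obtain ⟨N, hN⟩ := exists_nat_one_div_lt (half_pos he)
    have hb : ∀ n ≥ N, p (u n - x) < e / 2 := fun n hn =>
      ((hu n).trans (one_div_le_one_div_of_le (by positivity) (by gcongr))).trans_lt hN
    refine ⟨N, fun m hm n hn => ?_⟩
    have h1 : u m - u n = (u m - x) - (u n - x) := by abel
    have h2 := map_sub_le_add p (u m - x) (u n - x)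
    rw [h1]
    linarith [hb m hm, hb n hn])
  have t1 : Tendsto (fun n : ℕ => f (u (2 * n))) atTop (𝓝 y) :=
    hy.comp (tendsto_id.const_mul_atTop' two_pos)
  have t2 : Tendsto (fun n : ℕ => f (u (2 * n + 1))) atTop (𝓝 y) :=
    hy.comp (tendsto_atTop_mono (fun n => by simp only [id]; omega) tendsto_id)
  have e1 : ∀ n, u (2 * n) = x := fun n => by simp [u]
  have e2 : ∀ n, u (2 * n + 1) = w (2 * n + 1) := fun n => by simp [u]
  simp only [e1] at t1
  simp only [e2] at t2
  have hyx : f x = y := tendsto_nhds_unique tendsto_const_nhds t1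
  rw [← hyx, tendsto_iff_norm_sub_tendsto_zero] at t2
  have := ge_of_tendsto' t2 (fun n => hwf (2 * n + 1))
  linarith

theorem kz_seminorm {X Y : Type*} [AddCommGroup X] [Module ℝ X]
    [NormedAddCommGroup Y] [NormedSpace ℝ Y] [CompleteSpace Y] (p : Seminorm ℝ X)
    (hnorm : ∀ x : X, p x = 0 → x = 0)
    (hsep : ∃ S : Set X, S.Countable ∧ ∀ x : X, ∀ ε > (0:ℝ), ∃ s ∈ S, p (x - s) < ε)
    (f : X → Y)
    (hf : ∀ x, ∀ ε > (0:ℝ), ∃ δ > (0 : ℝ), ∀ y, p (y - x) < δ → ‖f y - f x‖ < ε)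
    (hpoly : ∃ (P : X → ℝ) (j : ℕ)
        (B : (n : ℕ) → MultilinearMap ℝ (fun _ : Fin n => X) ℝ),
      (∀ n, BoundedWrt p (B n)) ∧
      (∀ x : X, P x = ∑ n ∈ Finset.range (j + 1), B n (fun _ => x)) ∧
      P 0 = 0 ∧ ∀ x : X, p x = 1 → 1 ≤ |P x|) {ε : ℝ} (hε : 0 < ε) :
    ∃ h : X → Y, AnalyticWrt p h ∧ ∀ x : X, ‖f x - h x‖ < ε := by
  letI G : AddGroupNorm X :=
    { toFun := p
      map_zero' := map_zero p
      add_le' := map_add_le_add p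
      neg' := map_neg_eq_map p
      eq_zero_of_map_eq_zero' := hnorm }
  letI : NormedAddCommGroup X := G.toNormedAddCommGroup
  have hn : ∀ x : X, ‖x‖ = p x := fun x => rfl
  letI : NormedSpace ℝ X := { norm_smul_le := fun a x => (map_smul_eq_mul p a x).le }
  obtain ⟨S, hS, hSd⟩ := hsep
  haveI : TopologicalSpace.SeparableSpace X := ⟨S, hS, fun x => by
    rw [Metric.mem_closure_iff]
    intro e he
    obtain ⟨s, hs, h⟩ := hSd x e he
    exact ⟨s, hs, by rw [dist_eq_norm]; exact h⟩⟩
  haveI : SecondCountableTopology X := UniformSpace.secondCountable_of_separable X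
  have hfc : Continuous f := by
    rw [Metric.continuous_iff]
    intro x e he
    obtain ⟨d, hd, h⟩ := hf x e he
    refine ⟨d, hd, fun y hy => ?_⟩
    rw [dist_eq_norm] at hy ⊢
    exact h y hy
  obtain ⟨P, j, B, hB, hP, hP0, hP1⟩ := hpoly
  choose C hC using hB
  obtain ⟨h, ha, hfh⟩ := kz_poly f hfc j B (fun n => max (C n) 0) (fun n => le_max_right _ _)
    (fun n v => (hC n v).trans (mul_le_mul_of_nonneg_right (le_max_left _ _)
      (Finset.prod_nonneg fun i _ => apply_nonneg p _)))
    (by rw [← hP]; exact hP0) (fun x hx => by rw [← hP]; exact hP1 x hx) hε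
  refine ⟨h, fun x => ?_, hfh⟩
  obtain ⟨ps, R, hps⟩ := ha x
  obtain ⟨r, hr0, hrR⟩ := ENNReal.lt_iff_exists_nnreal_btwn.1 hps.r_pos
  have hu := hps.tendstoUniformlyOn' hrR
  refine ⟨r, by exact_mod_cast hr0, fun n => (ps n).toMultilinearMap,
    fun n => ⟨‖ps n‖, fun v => (ps n).le_opNorm v⟩, fun e he => ?_⟩
  rw [Metric.tendstoUniformlyOn_iff] at hu
  obtain ⟨N, hN⟩ := eventually_atTop.1 (hu e he)
  refine ⟨N, fun m hm y hy => ?_⟩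
  have := hN m hm y (by rw [Metric.mem_ball, dist_eq_norm]; exact hy)
  rw [dist_eq_norm] at this
  exact this

/-- Let `X` be a separable real Fréchet space whose topology comes from a
countable family of norms `(p_n)`, `Y` a real Banach space, and `f : X → Y` such that for
some `k` the image under `f` of every `p_k`-Cauchy sequence converges in `Y`.  Then `f`
is continuous on `X` and, if the completion of `(X, p_k)` admits a separating polynomial
(expressed here by a `p_k`-bounded polynomial `P` on `X` with `P 0 = 0` and `|P x| ≥ 1`
whenever `p_k x = 1`), then `f` is uniformly approximable by `p_k`-analytic maps. -/
theorem approximation_on_frechet_space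
    {X Y : Type*} [AddCommGroup X] [Module ℝ X]
    [NormedAddCommGroup Y] [NormedSpace ℝ Y] [CompleteSpace Y]
    (p : ℕ → Seminorm ℝ X)
    (hnorm : ∀ n, ∀ x : X, p n x = 0 → x = 0)
    (hsep : ∃ S : Set X, S.Countable ∧ ∀ x : X, ∀ ε > (0:ℝ), ∃ s ∈ S, frechetDist p x s < ε)
    (hcomplete : ∀ u : ℕ → X,
      (∀ ε > (0:ℝ), ∃ N, ∀ m ≥ N, ∀ n ≥ N, frechetDist p (u m) (u n) < ε) →
      ∃ x : X, Tendsto (fun n => frechetDist p (u n) x) atTop (𝓝 0))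
    (f : X → Y) (k : ℕ)
    (hf : ∀ u : ℕ → X,
      (∀ ε > (0:ℝ), ∃ N, ∀ m ≥ N, ∀ n ≥ N, p k (u m - u n) < ε) →
      ∃ y : Y, Tendsto (fun n => f (u n)) atTop (𝓝 y))
    (hpoly : ∃ (P : X → ℝ) (j : ℕ)
        (B : (n : ℕ) → MultilinearMap ℝ (fun _ : Fin n => X) ℝ),
      (∀ n, BoundedWrt (p k) (B n)) ∧
      (∀ x : X, P x = ∑ n ∈ Finset.range (j + 1), B n (fun _ => x)) ∧
      P 0 = 0 ∧ ∀ x : X, p k x = 1 → 1 ≤ |P x|) :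
    (∀ x : X, ∀ ε > (0:ℝ), ∃ δ > (0:ℝ), ∀ y : X,
        frechetDist p y x < δ → ‖f y - f x‖ < ε) ∧
    ∀ ε > (0:ℝ), ∃ h : X → Y, AnalyticWrt (p k) h ∧ ∀ x : X, ‖f x - h x‖ < ε := by
  have hfc := fun x ε (hε : (0 : ℝ) < ε) => seqcont_of_cauchy (p k) f hf x hε
  refine ⟨fun x ε hε => ?_, fun ε hε => ?_⟩
  · obtain ⟨δ, hδ, h⟩ := hfc x ε hε
    obtain ⟨η, hη, h'⟩ := frechetDist_small p k hδ
    exact ⟨η, hη, fun y hy => h y (h' y x hy)⟩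
  · refine kz_seminorm (p k) (hnorm k) ?_ f hfc hpoly hε
    obtain ⟨S, hS, hSd⟩ := hsep
    refine ⟨S, hS, fun x δ hδ => ?_⟩
    obtain ⟨η, hη, h'⟩ := frechetDist_small p k hδ
    obtain ⟨s, hs, h⟩ := hSd x η hη
    exact ⟨s, hs, h' x s h⟩
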